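/- Let K = ℚ(√D) with D ≥ 2 squarefree and (β_j) the ordered sequence of indecomposables with v_jβ_j = β_{j-1} + β_{j+1}. For α = 2β_j + β_{j+1}: if v_j ≥ 3 and (v_j, v_{j+1}) ≠ (3,2) then p_K(α) = 4; if (v_j, v_{j+1}) = (3,2) then p_K(α) = 5; if v_j = 2 and v_{j+1} ≥ 4 then p_K(α) = 6; if v_j = 2, v_{j+1} = 3, v_{j-1} > 2 then p_K(α) = 6; if v_j = 2, v_{j+1} = 3, v_{j-1} = 2 then p_K(α) = 7; and if v_j = v_{j+1} = 2 then p_K(α) ≥ 8. -/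

import Mathlib

noncomputable section

/-- `ω_D`: the standard generator of the ring of integers of `ℚ(√D)`. -/
def omegaD (D : ℕ) : ℝ := if D % 4 = 1 then (1 + Real.sqrt D) / 2 else Real.sqrt D

/-- The Galois conjugate of `ω_D`. -/
def omegaD' (D : ℕ) : ℝ := if D % 4 = 1 then (1 - Real.sqrt D) / 2 else -Real.sqrt D

/-- Elements of `O_K` in coordinates: `(x, y)` represents `x + y·ω_D`. -/
abbrev OK : Type := ℤ × ℤ

/-- First real embedding. -/
def emb1 (D : ℕ) (a : OK) : ℝ := a.1 + a.2 * omegaD D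

/-- Second real embedding (Galois conjugate). -/
def emb2 (D : ℕ) (a : OK) : ℝ := a.1 + a.2 * omegaD' D

/-- Galois conjugation on `O_K`. -/
def conjOK (D : ℕ) (a : OK) : OK := (a.1 + (if D % 4 = 1 then (1 : ℤ) else 0) * a.2, -a.2)

/-- Total positivity. -/
def TotPos (D : ℕ) (a : OK) : Prop := 0 < emb1 D a ∧ 0 < emb2 D a

/-- The field norm. -/
def Nm (D : ℕ) (a : OK) : ℝ := emb1 D a * emb2 D a

/-- Indecomposability: totally positive and not a sum of two totally positive elements. -/
def Indec (D : ℕ) (a : OK) : Prop :=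
  TotPos D a ∧ ¬ ∃ b c : OK, TotPos D b ∧ TotPos D c ∧ a = b + c

/-- Number of partitions of `α` into indecomposable parts (`p_K(α|I)`). -/
def pKI (D : ℕ) (α : OK) : ℕ :=
  Set.ncard {s : Multiset OK | (∀ x ∈ s, Indec D x) ∧ s.sum = α}

/-- Number of partitions of `α` into totally positive parts (`p_K(α)`). -/
def pK (D : ℕ) (α : OK) : ℕ :=
  Set.ncard {s : Multiset OK | (∀ x ∈ s, TotPos D x) ∧ s.sum = α}

/-- Discriminant of `ℚ(√D)`. -/
def disc (D : ℕ) : ℕ := if D % 4 = 1 then D else 4 * D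

/-- The ordered two-sided sequence of indecomposables together with
the coefficients `v j ≥ 2` from the Hejda–Kala relation `v_j β_j = β_{j-1} + β_{j+1}`. -/
structure BetaSeq (D : ℕ) (β : ℤ → OK) (v : ℤ → ℤ) : Prop where
  indec : ∀ j, Indec D (β j)
  surj : ∀ a : OK, Indec D a → ∃ j, β j = a
  mono : StrictMono fun j => emb1 D (β j)
  zero : β 0 = (1, 0)
  conj_eq : ∀ j, β (-j) = conjOK D (β j)
  v_two_le : ∀ j, 2 ≤ v j
  v_symm : ∀ j, v (-j) = v j
  rel : ∀ j, v j • β j = β (j - 1) + β (j + 1)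

/-- The continued fraction data of `ω_D = [⌈u₀/2⌉, \overline{u₁, …, u_s}]` (with `u_s = u_0`),
with tails `γ_0 = ω_D`, `γ_i = [u_i, u_{i+1}, …]` for `i ≥ 1`. -/
structure CFData (D : ℕ) (u : ℕ → ℕ) (γ : ℕ → ℝ) : Prop where
  gamma_zero : γ 0 = omegaD D
  u_zero : (u 0 : ℤ) = 2 * ⌊omegaD D⌋ - (if D % 4 = 1 then 1 else 0)
  head : omegaD D = (⌊omegaD D⌋ : ℝ) + 1 / γ 1
  step : ∀ i, 1 ≤ i → γ i = u i + 1 / γ (i + 1)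
  one_lt : ∀ i, 1 ≤ i → 1 < γ i
  floor_eq : ∀ i, 1 ≤ i → (u i : ℤ) = ⌊γ i⌋
  period : ∃ s, 1 ≤ s ∧ u s = u 0 ∧ ∀ i, 1 ≤ i → u (i + s) = u i

/-- The convergents `α_i = p_i + q_i ξ_D`, indexed by `i ≥ -1`. -/
structure ConvData (D : ℕ) (u : ℕ → ℕ) (a : ℤ → OK) : Prop where
  neg_one : a (-1) = (1, 0)
  zero : a 0 = (⌊omegaD D⌋, 0) + (if D % 4 = 1 then ((-1 : ℤ), (1 : ℤ)) else (0, 1))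
  recur : ∀ i : ℤ, -1 ≤ i → a (i + 2) = (u (i + 2).toNat : ℤ) • a (i + 1) + a i

/-- Semiconvergents `α_{i,r} = α_i + r·α_{i+1}`. -/
def semiconv (a : ℤ → OK) (i r : ℤ) : OK := a i + r • a (i + 1)

theorem h16_emb1_add (D : ℕ) (a b : OK) : emb1 D (a + b) = emb1 D a + emb1 D b := by
  simp only [emb1, Prod.fst_add, Prod.snd_add]; push_cast; ring

theorem h16_emb2_add (D : ℕ) (a b : OK) : emb2 D (a + b) = emb2 D a + emb2 D b := by
  simp only [emb2, Prod.fst_add, Prod.snd_add]; push_cast; ring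

theorem h16_tp_add (D : ℕ) {a b : OK} (ha : TotPos D a) (hb : TotPos D b) : TotPos D (a + b) := by
  refine ⟨?_, ?_⟩
  · rw [h16_emb1_add]; exact add_pos ha.1 hb.1
  · rw [h16_emb2_add]; exact add_pos ha.2 hb.2

/-- The trace, an integer. -/
def h16Tr (D : ℕ) (a : OK) : ℤ := 2 * a.1 + (if D % 4 = 1 then 1 else 0) * a.2

theorem h16_tr (D : ℕ) (a : OK) : (h16Tr D a : ℝ) = emb1 D a + emb2 D a := by
  simp only [h16Tr, emb1, emb2, omegaD, omegaD']
  split_ifs <;> push_cast <;> ring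

theorem h16_tr_pos (D : ℕ) {a : OK} (ha : TotPos D a) : 0 < h16Tr D a := by
  have := h16_tr D a
  have h2 : (0 : ℝ) < h16Tr D a := by rw [this]; exact add_pos ha.1 ha.2
  exact_mod_cast h2

theorem h16_tr_add (D : ℕ) (a b : OK) : h16Tr D (a + b) = h16Tr D a + h16Tr D b := by
  simp only [h16Tr, Prod.fst_add, Prod.snd_add]; ring

/-- Induction principle for totally positive elements. -/
theorem h16_ind (D : ℕ) (P : OK → Prop) (h1 : ∀ a, Indec D a → P a)
    (h2 : ∀ a b, P a → P b → P (a + b)) : ∀ a, TotPos D a → P a := by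
  have key : ∀ n : ℕ, ∀ a, TotPos D a → h16Tr D a ≤ n → P a := by
    intro n
    induction n with
    | zero => intro a ha hn; have := h16_tr_pos D ha; simp at hn; omega
    | succ n ih =>
      intro a ha hn
      by_cases hi : Indec D a
      · exact h1 a hi
      · have : ∃ b c : OK, TotPos D b ∧ TotPos D c ∧ a = b + c := by
          by_contra hc; exact hi ⟨ha, hc⟩
        obtain ⟨b, c, hb, hc, rfl⟩ := this
        have p1 := h16_tr_pos D hb
        have p2 := h16_tr_pos D hc
        rw [h16_tr_add] at hn
        push_cast at hn
        exact h2 b c (ih b hb (by omega)) (ih c hc (by omega))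
  intro a ha
  exact key (h16Tr D a).toNat a ha (Int.self_le_toNat _)

theorem h16_beta_up (D : ℕ) (β : ℤ → OK) (v : ℤ → ℤ) (hβ : BetaSeq D β v) (k : ℤ) (n : ℕ) :
    ∃ x y x' y' : ℤ, β (k + n) = x • β k + y • β (k + 1) ∧
      β (k + n + 1) = x' • β k + y' • β (k + 1) ∧ 1 ≤ x + y ∧ x + y ≤ x' + y' := by
  induction n with
  | zero => exact ⟨1, 0, 0, 1, by simp, by simp, by norm_num, by norm_num⟩
  | succ n ih =>
    obtain ⟨x, y, x', y', h1, h2, h3, h4⟩ := ih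
    have hr := hβ.rel (k + n + 1)
    have hv := hβ.v_two_le (k + n + 1)
    have e1 : k + (n : ℤ) + 1 - 1 = k + n := by ring
    rw [e1, h1] at hr
    refine ⟨x', y', v (k + n + 1) * x' - x, v (k + n + 1) * y' - y, ?_, ?_, by linarith, ?_⟩
    · rw [← h2]; congr 1; push_cast; ring
    · have e2 : k + ((n + 1 : ℕ) : ℤ) + 1 = k + n + 1 + 1 := by push_cast; ring
      rw [e2, ← sub_eq_iff_eq_add'.mpr hr, h2]
      module
    · nlinarith

theorem h16_beta_down (D : ℕ) (β : ℤ → OK) (v : ℤ → ℤ) (hβ : BetaSeq D β v) (k : ℤ) (n : ℕ) :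
    ∃ x y x' y' : ℤ, β (k + 1 - n) = x • β k + y • β (k + 1) ∧
      β (k - n) = x' • β k + y' • β (k + 1) ∧ 1 ≤ x + y ∧ x + y ≤ x' + y' := by
  induction n with
  | zero => exact ⟨0, 1, 1, 0, by simp, by simp, by norm_num, by norm_num⟩
  | succ n ih =>
    obtain ⟨x, y, x', y', h1, h2, h3, h4⟩ := ih
    have hr := hβ.rel (k - n)
    have hv := hβ.v_two_le (k - n)
    have e1 : k - (n : ℤ) + 1 = k + 1 - n := by ring
    rw [e1, h1] at hr
    refine ⟨x', y', v (k - n) * x' - x, v (k - n) * y' - y, ?_, ?_, by linarith, ?_⟩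
    · rw [← h2]; congr 1; push_cast; ring
    · have e2 : k - ((n + 1 : ℕ) : ℤ) = k - n - 1 := by push_cast; ring
      rw [e2, ← sub_eq_iff_eq_add.mpr hr, h2]
      module
    · nlinarith

theorem h16_beta (D : ℕ) (β : ℤ → OK) (v : ℤ → ℤ) (hβ : BetaSeq D β v) (k i : ℤ) :
    ∃ x y : ℤ, β i = x • β k + y • β (k + 1) ∧ 1 ≤ x + y := by
  rcases le_total k i with h | h
  · obtain ⟨x, y, x', y', h1, -, h3, -⟩ := h16_beta_up D β v hβ k (i - k).toNat
    refine ⟨x, y, ?_, h3⟩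
    rw [← h1]; congr 1; omega
  · obtain ⟨x, y, x', y', -, h2, h3, h4⟩ := h16_beta_down D β v hβ k (k - i).toNat
    refine ⟨x', y', ?_, by linarith⟩
    rw [← h2]; congr 1; omega

theorem h16_tp (D : ℕ) (β : ℤ → OK) (v : ℤ → ℤ) (hβ : BetaSeq D β v) (k : ℤ) :
    ∀ a, TotPos D a → ∃ x y : ℤ, a = x • β k + y • β (k + 1) ∧ 1 ≤ x + y := by
  apply h16_ind
  · intro a ha
    obtain ⟨i, rfl⟩ := hβ.surj a ha
    exact h16_beta D β v hβ k i
  · rintro a b ⟨x, y, rfl, h⟩ ⟨x', y', rfl, h'⟩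
    exact ⟨x + x', y + y', by module, by linarith⟩

/-- Coordinates with respect to two elements. -/
def h16E (a b : OK) : (ℤ × ℤ) →ₗ[ℤ] (ℤ × ℤ) :=
  (LinearMap.fst ℤ ℤ ℤ).smulRight a + (LinearMap.snd ℤ ℤ ℤ).smulRight b

theorem h16E_apply (a b : OK) (p : ℤ × ℤ) : h16E a b p = p.1 • a + p.2 • b := by
  simp [h16E]

theorem h16E_bij (D : ℕ) (β : ℤ → OK) (v : ℤ → ℤ) (hβ : BetaSeq D β v) (k : ℤ) :
    Function.Bijective (h16E (β k) (β (k + 1))) := by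
  have hs : Function.Surjective (h16E (β k) (β (k + 1))) := by
    intro g
    obtain ⟨N, hN⟩ := exists_nat_gt (max 0 (max (-emb1 D g) (-emb2 D g)))
    have q0 : (0 : ℝ) < N := lt_of_le_of_lt (le_max_left _ _) hN
    have q1 : -emb1 D g < N := lt_of_le_of_lt ((le_max_left _ _).trans (le_max_right _ _)) hN
    have q2 : -emb2 D g < N := lt_of_le_of_lt ((le_max_right _ _).trans (le_max_right _ _)) hN
    have f1 : emb1 D ((N : ℤ), 0) = N := by simp [emb1]
    have f2 : emb2 D ((N : ℤ), 0) = N := by simp [emb2]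
    have t1 : TotPos D ((N : ℤ), 0) := ⟨by rw [f1]; exact q0, by rw [f2]; exact q0⟩
    have t2 : TotPos D (g + ((N : ℤ), 0)) :=
      ⟨by rw [h16_emb1_add, f1]; linarith, by rw [h16_emb2_add, f2]; linarith⟩
    obtain ⟨x, y, h, -⟩ := h16_tp D β v hβ k _ t1
    obtain ⟨x', y', h', -⟩ := h16_tp D β v hβ k _ t2
    refine ⟨(x' - x, y' - y), ?_⟩
    rw [h16E_apply]
    have : g = (g + ((N : ℤ), 0)) - ((N : ℤ), 0) := by abel
    rw [this, h', h]
    module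
  exact ⟨OrzechProperty.injective_of_surjective_endomorphism _ hs, hs⟩

theorem h16_fin (D : ℕ) (hD : 2 ≤ D) (α : OK) :
    {g : OK | TotPos D g ∧ TotPos D (α - g)}.Finite := by
  have hs : (1 : ℝ) ≤ Real.sqrt D := by
    rw [Real.one_le_sqrt]; exact_mod_cast (by omega : 1 ≤ D)
  have hw : 1 ≤ omegaD D - omegaD' D := by
    simp only [omegaD, omegaD']; split_ifs <;> linarith
  obtain ⟨M, hM⟩ := exists_nat_gt (max (emb1 D α) (emb2 D α))
  have m1 : emb1 D α < M := lt_of_le_of_lt (le_max_left _ _) hM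
  have m2 : emb2 D α < M := lt_of_le_of_lt (le_max_right _ _) hM
  obtain ⟨C, hC⟩ := exists_nat_gt |omegaD D|
  apply Set.Finite.subset
    (Set.Finite.prod (Set.finite_Icc (-((M : ℤ) + M * C)) (M + M * C))
      (Set.finite_Icc (-(M : ℤ)) M))
  rintro g ⟨h1, h2⟩
  have k1 : emb1 D (α - g) = emb1 D α - emb1 D g := by
    have := h16_emb1_add D (α - g) g
    rw [sub_add_cancel] at this; linarith
  have k2 : emb2 D (α - g) = emb2 D α - emb2 D g := by
    have := h16_emb2_add D (α - g) g
    rw [sub_add_cancel] at this; linarith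
  have a1 := h1.1
  have a2 := h1.2
  have b1 := h2.1
  have b2 := h2.2
  rw [k1] at b1
  rw [k2] at b2
  have d1 : emb1 D g - emb2 D g = g.2 * (omegaD D - omegaD' D) := by
    simp only [emb1, emb2]; ring
  have y1 : |(g.2 : ℝ)| ≤ M := by
    have : |(g.2 : ℝ) * (omegaD D - omegaD' D)| ≤ M := by
      rw [← d1, abs_le]; constructor <;> linarith
    rw [abs_mul] at this
    have h3 : 1 ≤ |omegaD D - omegaD' D| := hw.trans (le_abs_self _)
    nlinarith [abs_nonneg (g.2 : ℝ)]
  have x1 : |(g.1 : ℝ)| ≤ M + M * C := by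
    have e : (g.1 : ℝ) = emb1 D g - g.2 * omegaD D := by simp only [emb1]; ring
    rw [e]
    refine (abs_sub _ _).trans ?_
    rw [abs_mul, abs_of_pos a1]
    have : |(g.2 : ℝ)| * |omegaD D| ≤ M * C :=
      mul_le_mul y1 hC.le (abs_nonneg _) (by positivity)
    linarith
  rw [abs_le] at x1 y1
  refine ⟨⟨?_, ?_⟩, ⟨?_, ?_⟩⟩
  · exact_mod_cast x1.1
  · exact_mod_cast x1.2
  · exact_mod_cast y1.1
  · exact_mod_cast y1.2

/-- The combinatorial data. -/
structure H16 (T : ℤ × ℤ → Prop) (u v w : ℤ) : Prop where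
  add : ∀ p q, T p → T q → T (p + q)
  a : T (1, 0)
  b : T (0, 1)
  am : T (v, -1)
  bp : T (-1, w)
  amm : T (u * v - 1, -u)
  l0 : ∀ p, T p → 1 ≤ p.1 + p.2
  lm : ∀ p, T p → 1 ≤ p.1 + (v - 1) * p.2
  lp : ∀ p, T p → 1 ≤ (w - 1) * p.1 + p.2
  lmm : ∀ p, T p → 1 ≤ (u - 1) * p.1 + ((u - 1) * v - 1) * p.2
  fin : {p | T p ∧ T ((2, 1) - p)}.Finite

/-- Partitions of `(2,1)`. -/
def h16S (T : ℤ × ℤ → Prop) : Set (Multiset (ℤ × ℤ)) := {s | (∀ x ∈ s, T x) ∧ s.sum = (2, 1)}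

theorem h16_pK (D : ℕ) (hD : 2 ≤ D) (β : ℤ → OK) (v : ℤ → ℤ) (hβ : BetaSeq D β v)
    (j : ℤ) (α : OK) (hα : α = (2 : ℤ) • β j + β (j + 1)) :
    ∃ T, H16 T (v (j - 1)) (v j) (v (j + 1)) ∧ pK D α = (h16S T).ncard := by
  have hb := h16E_bij D β v hβ j
  have ha := h16E_apply (β j) (β (j + 1))
  have hα' : h16E (β j) (β (j + 1)) (2, 1) = α := by rw [ha, hα]; simp
  have r0 := hβ.rel j
  have r1 := hβ.rel (j + 1)
  have r2 := hβ.rel (j - 1)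
  rw [add_sub_cancel_right] at r1
  rw [sub_add_cancel] at r2
  have c1 : β (j - 1) = v j • β j - β (j + 1) := by rw [r0]; abel
  have c2 : β (j + 1 + 1) = v (j + 1) • β (j + 1) - β j := by rw [r1]; abel
  have c3 : β (j - 1 - 1) = v (j - 1) • β (j - 1) - β j := by rw [r2]; abel
  refine ⟨fun p => TotPos D (h16E (β j) (β (j + 1)) p), ?_, ?_⟩
  · constructor
    · intro p q hp hq
      simp only [map_add]; exact h16_tp_add D hp hq
    · simp only [ha]; simpa using (hβ.indec j).1
    · simp only [ha]; simpa using (hβ.indec (j + 1)).1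
    · have := (hβ.indec (j - 1)).1
      simp only [ha]; convert this using 1; rw [c1]; module
    · have := (hβ.indec (j + 1 + 1)).1
      simp only [ha]; convert this using 1; rw [c2]; module
    · have := (hβ.indec (j - 1 - 1)).1
      simp only [ha]; convert this using 1; rw [c3, c1]; module
    · intro p hp
      obtain ⟨x, y, h, h'⟩ := h16_tp D β v hβ j _ hp
      have : p = (x, y) := hb.1 (by rw [h, ha])
      rw [this]; exact h'
    · intro p hp
      obtain ⟨x, y, h, h'⟩ := h16_tp D β v hβ (j - 1) _ hp
      rw [sub_add_cancel] at h
      have : p = (x * v j + y, -x) := hb.1 (by rw [h, ha, c1]; module)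
      rw [this]; simp only; linarith
    · intro p hp
      obtain ⟨x, y, h, h'⟩ := h16_tp D β v hβ (j + 1) _ hp
      have : p = (-y, x + y * v (j + 1)) := hb.1 (by rw [h, ha, c2]; module)
      rw [this]; simp only; linarith
    · intro p hp
      obtain ⟨x, y, h, h'⟩ := h16_tp D β v hβ (j - 1 - 1) _ hp
      rw [sub_add_cancel] at h
      have : p = (x * (v (j - 1) * v j - 1) + y * v j, -x * v (j - 1) - y) :=
        hb.1 (by rw [h, ha, c3, c1]; module)
      rw [this]; simp only; linarith
    · have := (h16_fin D hD α).preimage (hb.1.injOn (s := h16E (β j) (β (j + 1)) ⁻¹'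
        {g : OK | TotPos D g ∧ TotPos D (α - g)}))
      convert this using 1
      ext p
      simp only [Set.mem_ofPred_eq, Set.mem_preimage, map_sub, hα']
  · have : {s : Multiset OK | (∀ x ∈ s, TotPos D x) ∧ s.sum = α} =
      Multiset.map (h16E (β j) (β (j + 1))) ''
        h16S (fun p => TotPos D (h16E (β j) (β (j + 1)) p)) := by
      ext s
      simp only [Set.mem_ofPred_eq, Set.mem_image, h16S]
      constructor
      · rintro ⟨h1, h2⟩
        obtain ⟨t, rfl⟩ := Multiset.map_surjective_of_surjective hb.2 s
        refine ⟨t, ⟨fun x hx => h1 _ (Multiset.mem_map_of_mem _ hx), hb.1 ?_⟩, rfl⟩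
        rw [hα', ← h2, map_multiset_sum]
      · rintro ⟨t, ⟨h1, h2⟩, rfl⟩
        refine ⟨?_, ?_⟩
        · intro x hx
          obtain ⟨y, hy, rfl⟩ := Multiset.mem_map.mp hx
          exact h1 y hy
        · rw [← map_multiset_sum, h2, hα']
    rw [pK, this, Set.ncard_image_of_injective _ (Multiset.map_injective hb.1)]

theorem h16_sum_card (T : ℤ × ℤ → Prop) (h : ∀ p, T p → 1 ≤ p.1 + p.2)
    (s : Multiset (ℤ × ℤ)) : (∀ x ∈ s, T x) → (s.card : ℤ) ≤ s.sum.1 + s.sum.2 := by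
  induction s using Multiset.induction_on with
  | empty => simp
  | cons a s ih =>
    intro hs
    have h1 := h a (hs a (by simp))
    have h2 := ih (fun x hx => hs x (Multiset.mem_cons_of_mem hx))
    simp only [Multiset.card_cons, Multiset.sum_cons, Prod.fst_add, Prod.snd_add]
    push_cast
    linarith

/-- Shape of the partitions of `(2,1)`. -/
theorem h16_shape {T : ℤ × ℤ → Prop} {u v w : ℤ} (H : H16 T u v w) (s : Multiset (ℤ × ℤ)) :
    s ∈ h16S T ↔ s = {(2, 1)} ∨
      (∃ x : ℤ, T (x, 1 - x) ∧ T (2 - x, x) ∧ s = {(x, 1 - x), (2 - x, x)}) ∨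
      (∃ x y : ℤ, T (x, 1 - x) ∧ T (y, 1 - y) ∧ T (2 - x - y, x + y - 1) ∧
        s = {(x, 1 - x), (y, 1 - y), (2 - x - y, x + y - 1)}) := by
  constructor
  · rintro ⟨h1, h2⟩
    have hc := h16_sum_card T H.l0 s h1
    rw [h2] at hc
    have hc' : s.card ≤ 3 := by norm_num at hc; exact_mod_cast hc
    have hcases : s.card = 0 ∨ s.card = 1 ∨ s.card = 2 ∨ s.card = 3 := by omega
    rcases hcases with h | h | h | h
    · rw [Multiset.card_eq_zero] at h
      subst h; exact absurd (congrArg Prod.fst h2) (by simp)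
    · obtain ⟨p, rfl⟩ := Multiset.card_eq_one.mp h
      left; simpa using h2
    · obtain ⟨p, q, rfl⟩ := Multiset.card_eq_two.mp h
      right; left
      obtain ⟨p1, p2⟩ := p
      obtain ⟨q1, q2⟩ := q
      have t1 := h1 (p1, p2) (by simp)
      have t2 := h1 (q1, q2) (by simp)
      have l1 := H.l0 _ t1
      have l2 := H.l0 _ t2
      simp only [Multiset.insert_eq_cons, Multiset.sum_cons, Multiset.sum_singleton,
        Prod.mk_add_mk, Prod.mk.injEq] at h2
      simp only at l1 l2
      rcases (by omega : p1 + p2 = 1 ∨ q1 + q2 = 1) with hh | hh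
      · have e1 : p2 = 1 - p1 := by omega
        have e2 : q1 = 2 - p1 := by omega
        have e3 : q2 = p1 := by omega
        subst e1 e2 e3
        exact ⟨_, t1, t2, rfl⟩
      · have e1 : q2 = 1 - q1 := by omega
        have e2 : p1 = 2 - q1 := by omega
        have e3 : p2 = q1 := by omega
        subst e1 e2 e3
        exact ⟨_, t2, t1, Multiset.pair_comm _ _⟩
    · obtain ⟨p, q, r, rfl⟩ := Multiset.card_eq_three.mp h
      right; right
      obtain ⟨p1, p2⟩ := p
      obtain ⟨q1, q2⟩ := q
      obtain ⟨r1, r2⟩ := r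
      have t1 := h1 (p1, p2) (by simp)
      have t2 := h1 (q1, q2) (by simp)
      have t3 := h1 (r1, r2) (by simp)
      have l1 := H.l0 _ t1
      have l2 := H.l0 _ t2
      have l3 := H.l0 _ t3
      simp only [Multiset.insert_eq_cons, Multiset.sum_cons, Multiset.sum_singleton,
        Prod.mk_add_mk, Prod.mk.injEq] at h2
      simp only at l1 l2 l3
      have e1 : p2 = 1 - p1 := by omega
      have e2 : q2 = 1 - q1 := by omega
      have e3 : r1 = 2 - p1 - q1 := by omega
      have e4 : r2 = p1 + q1 - 1 := by omega
      subst e1 e2 e3 e4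
      exact ⟨_, _, t1, t2, t3, rfl⟩
  · have h21 : T (2, 1) := by
      have := H.add _ _ (H.add _ _ H.a H.a) H.b
      simpa using this
    rintro (rfl | ⟨x, h1, h2, rfl⟩ | ⟨x, y, h1, h2, h3, rfl⟩)
    · exact ⟨by simpa using h21, by simp⟩
    · exact ⟨by simp [h1, h2], by simp⟩
    · refine ⟨by simp [h1, h2, h3], ?_⟩
      simp only [Multiset.insert_eq_cons, Multiset.sum_cons, Multiset.sum_singleton,
        Prod.mk_add_mk, Prod.mk.injEq]
      constructor <;> ring

theorem h16_S_fin {T : ℤ × ℤ → Prop} {u v w : ℤ} (H : H16 T u v w) : (h16S T).Finite := by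
  have f1 : {x : ℤ | T (x, 1 - x) ∧ T (2 - x, x)}.Finite := by
    refine Set.Finite.of_finite_image (f := fun x : ℤ => ((x, 1 - x) : ℤ × ℤ))
      (H.fin.subset ?_) (fun x _ y _ h => (Prod.mk.inj h).1)
    rintro _ ⟨x, ⟨h1, h2⟩, rfl⟩
    refine ⟨h1, ?_⟩
    convert h2 using 1
    ext <;> simp
  refine ((Set.finite_singleton {((2 : ℤ), (1 : ℤ))}).union
    ((f1.image (fun x : ℤ => ({(x, 1 - x), (2 - x, x)} : Multiset (ℤ × ℤ)))).union
    ((f1.prod f1).image (fun q : ℤ × ℤ => ({(q.1, 1 - q.1), (q.2, 1 - q.2),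
      (2 - q.1 - q.2, q.1 + q.2 - 1)} : Multiset (ℤ × ℤ)))))).subset ?_
  intro s hs
  rw [h16_shape H] at hs
  rcases hs with rfl | ⟨x, h1, h2, rfl⟩ | ⟨x, y, h1, h2, h3, rfl⟩
  · left; rfl
  · right; left; exact ⟨x, ⟨h1, h2⟩, rfl⟩
  · right; right
    refine ⟨(x, y), ⟨⟨h1, ?_⟩, ⟨h2, ?_⟩⟩, rfl⟩
    · have := H.add _ _ h2 h3
      convert this using 1
      ext <;> simp <;> ring
    · have := H.add _ _ h1 h3
      convert this using 1
      ext <;> simp <;> ring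

/-- Two-part partition. -/
def h16M2 (x : ℤ) : Multiset (ℤ × ℤ) := {(x, 1 - x), (2 - x, x)}

/-- Three-part partition. -/
def h16M3 (x y : ℤ) : Multiset (ℤ × ℤ) := {(x, 1 - x), (y, 1 - y), (2 - x - y, x + y - 1)}

theorem h16_mem1 {T : ℤ × ℤ → Prop} {u v w : ℤ} (H : H16 T u v w) : {(2, 1)} ∈ h16S T :=
  (h16_shape H _).mpr (Or.inl rfl)

theorem h16_mem2 {T : ℤ × ℤ → Prop} {u v w : ℤ} (H : H16 T u v w) (x : ℤ)
    (h1 : T (x, 1 - x)) (h2 : T (2 - x, x)) : h16M2 x ∈ h16S T :=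
  (h16_shape H _).mpr (Or.inr (Or.inl ⟨x, h1, h2, rfl⟩))

theorem h16_mem3 {T : ℤ × ℤ → Prop} {u v w : ℤ} (H : H16 T u v w) (x y : ℤ)
    (h1 : T (x, 1 - x)) (h2 : T (y, 1 - y)) (h3 : T (2 - x - y, x + y - 1)) :
    h16M3 x y ∈ h16S T :=
  (h16_shape H _).mpr (Or.inr (Or.inr ⟨x, y, h1, h2, h3, rfl⟩))

/-- Exact count from a list of partitions. -/
theorem h16_count {T : ℤ × ℤ → Prop} {u v w : ℤ} (H : H16 T u v w)
    (F : Finset (Multiset (ℤ × ℤ))) (h0 : ∀ s ∈ F, s ∈ h16S T) (h1 : {(2, 1)} ∈ F)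
    (h2 : ∀ x, T (x, 1 - x) → T (2 - x, x) → h16M2 x ∈ F)
    (h3 : ∀ x y, T (x, 1 - x) → T (y, 1 - y) → T (2 - x - y, x + y - 1) → h16M3 x y ∈ F) :
    (h16S T).ncard = F.card := by
  have : h16S T = ↑F := by
    ext s
    refine ⟨fun hs => ?_, fun hs => h0 s hs⟩
    rcases (h16_shape H s).mp hs with rfl | ⟨x, a, b, rfl⟩ | ⟨x, y, a, b, c, rfl⟩
    · exact h1
    · exact h2 x a b
    · exact h3 x y a b c
  rw [this, Set.ncard_coe_finset]

theorem h16_case1 {T : ℤ × ℤ → Prop} {u v w : ℤ} (H : H16 T u v w) (hv : 3 ≤ v) (hw : 2 ≤ w)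
    (hn : ¬ (v = 3 ∧ w = 2)) : (h16S T).ncard = 4 := by
  have hx1 : ∀ x, T (x, 1 - x) → x ≤ 1 := fun x h => by
    have := H.lm _ h; simp only at this; by_contra hc; push Not at hc; nlinarith
  have h11 := H.add _ _ H.a H.b
  have h20 := H.add _ _ H.a H.a
  have := h16_count H {{(2, 1)}, h16M2 0, h16M2 1, h16M3 0 1} ?_ (by decide) ?_ ?_
  · rw [this]; decide
  · intro s hs
    simp only [Finset.mem_insert, Finset.mem_singleton] at hs
    rcases hs with rfl | rfl | rfl | rfl
    · exact h16_mem1 H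
    · exact h16_mem2 H 0 H.b h20
    · exact h16_mem2 H 1 H.a h11
    · exact h16_mem3 H 0 1 H.b H.a H.a
  · intro x h1 h2
    have l1 := hx1 x h1
    have l2 : 0 ≤ x := by
      by_contra hc
      have q1 := H.lm _ h2
      have q2 := H.lp _ h1
      simp only at q1 q2
      have hx : x ≤ -1 := by omega
      rcases (by omega : 4 ≤ v ∨ 3 ≤ w) with h | h <;> nlinarith
    interval_cases x <;> decide
  · intro x y h1 h2 h3
    have l1 := hx1 x h1
    have l2 := hx1 y h2
    have l3 := hx1 (2 - x - y) (by convert h3 using 2; ring)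
    have : 0 ≤ x := by omega
    have : 0 ≤ y := by omega
    interval_cases x <;> interval_cases y <;> first | omega | decide

theorem h16_case2 {T : ℤ × ℤ → Prop} {u v w : ℤ} (H : H16 T u v w) (hv : v = 3)
    (hw : w = 2) : (h16S T).ncard = 5 := by
  subst hv hw
  have hx1 : ∀ x, T (x, 1 - x) → x ≤ 1 := fun x h => by
    have := H.lm _ h; simp only at this; linarith
  have h11 := H.add _ _ H.a H.b
  have h20 := H.add _ _ H.a H.a
  have := h16_count H {{(2, 1)}, h16M2 0, h16M2 1, h16M2 (-1), h16M3 0 1} ?_ (by decide) ?_ ?_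
  · rw [this]; decide
  · intro s hs
    simp only [Finset.mem_insert, Finset.mem_singleton] at hs
    rcases hs with rfl | rfl | rfl | rfl | rfl
    · exact h16_mem1 H
    · exact h16_mem2 H 0 H.b h20
    · exact h16_mem2 H 1 H.a h11
    · exact h16_mem2 H (-1) H.bp H.am
    · exact h16_mem3 H 0 1 H.b H.a H.a
  · intro x h1 h2
    have l1 := hx1 x h1
    have l2 : -1 ≤ x := by
      have q1 := H.lm _ h2
      simp only at q1
      linarith
    interval_cases x <;> decide
  · intro x y h1 h2 h3
    have l1 := hx1 x h1
    have l2 := hx1 y h2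
    have l3 := hx1 (2 - x - y) (by convert h3 using 2; ring)
    have : 0 ≤ x := by omega
    have : 0 ≤ y := by omega
    interval_cases x <;> interval_cases y <;> first | omega | decide

theorem h16_case3 {T : ℤ × ℤ → Prop} {u v w : ℤ} (H : H16 T u v w) (hv : v = 2)
    (hw : 4 ≤ w ∨ (w = 3 ∧ 2 < u)) : (h16S T).ncard = 6 := by
  subst hv
  have hw3 : 3 ≤ w := by omega
  have hx1 : ∀ x, T (x, 1 - x) → 0 ≤ x := fun x h => by
    have := H.lp _ h; simp only at this; by_contra hc; push Not at hc; nlinarith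
  have h11 := H.add _ _ H.a H.b
  have h20 := H.add _ _ H.a H.a
  have h02 := H.add _ _ H.b H.b
  have := h16_count H {{(2, 1)}, h16M2 0, h16M2 1, h16M2 2, h16M3 0 1, h16M3 0 0} ?_
    (by decide) ?_ ?_
  · rw [this]; decide
  · intro s hs
    simp only [Finset.mem_insert, Finset.mem_singleton] at hs
    rcases hs with rfl | rfl | rfl | rfl | rfl | rfl
    · exact h16_mem1 H
    · exact h16_mem2 H 0 H.b h20
    · exact h16_mem2 H 1 H.a h11
    · exact h16_mem2 H 2 H.am h02
    · exact h16_mem3 H 0 1 H.b H.a H.a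
    · exact h16_mem3 H 0 0 H.b H.b H.am
  · intro x h1 h2
    have l1 := hx1 x h1
    have l2 : x ≤ 2 := by
      by_contra hc
      have q1 := H.lp _ h2
      have q2 := H.lmm _ h1
      simp only at q1 q2
      have hx : 3 ≤ x := by omega
      rcases hw with h | ⟨h, h'⟩
      · nlinarith
      · nlinarith
    interval_cases x <;> decide
  · intro x y h1 h2 h3
    have l1 := hx1 x h1
    have l2 := hx1 y h2
    have l3 := hx1 (2 - x - y) (by convert h3 using 2; ring)
    have : x ≤ 2 := by omega
    have : y ≤ 2 := by omega
    interval_cases x <;> interval_cases y <;> first | omega | decide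

theorem h16_case5 {T : ℤ × ℤ → Prop} {u v w : ℤ} (H : H16 T u v w) (hv : v = 2)
    (hw : w = 3) (hu : u = 2) : (h16S T).ncard = 7 := by
  subst hv hw hu
  have hx1 : ∀ x, T (x, 1 - x) → 0 ≤ x := fun x h => by
    have := H.lp _ h; simp only at this; linarith
  have h11 := H.add _ _ H.a H.b
  have h20 := H.add _ _ H.a H.a
  have h02 := H.add _ _ H.b H.b
  have := h16_count H {{(2, 1)}, h16M2 0, h16M2 1, h16M2 2, h16M2 3, h16M3 0 1, h16M3 0 0} ?_
    (by decide) ?_ ?_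
  · rw [this]; decide
  · intro s hs
    simp only [Finset.mem_insert, Finset.mem_singleton] at hs
    rcases hs with rfl | rfl | rfl | rfl | rfl | rfl | rfl
    · exact h16_mem1 H
    · exact h16_mem2 H 0 H.b h20
    · exact h16_mem2 H 1 H.a h11
    · exact h16_mem2 H 2 H.am h02
    · exact h16_mem2 H 3 H.amm H.bp
    · exact h16_mem3 H 0 1 H.b H.a H.a
    · exact h16_mem3 H 0 0 H.b H.b H.am
  · intro x h1 h2
    have l1 := hx1 x h1
    have l2 : x ≤ 3 := by
      have q1 := H.lp _ h2
      simp only at q1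
      linarith
    interval_cases x <;> decide
  · intro x y h1 h2 h3
    have l1 := hx1 x h1
    have l2 := hx1 y h2
    have l3 := hx1 (2 - x - y) (by convert h3 using 2; ring)
    have : x ≤ 2 := by omega
    have : y ≤ 2 := by omega
    interval_cases x <;> interval_cases y <;> first | omega | decide

theorem h16_case6 {T : ℤ × ℤ → Prop} {u v w : ℤ} (H : H16 T u v w) (hv : v = 2)
    (hw : w = 2) : 8 ≤ (h16S T).ncard := by
  subst hv hw
  have h11 := H.add _ _ H.a H.b
  have h20 := H.add _ _ H.a H.a
  have h02 := H.add _ _ H.b H.b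
  have h31 := H.add _ _ H.a H.am
  have hc : ({{(2, 1)}, h16M2 (-1), h16M2 0, h16M2 1, h16M2 2, h16M3 0 1, h16M3 0 0,
    h16M3 (-1) 1} : Finset (Multiset (ℤ × ℤ))).card = 8 := by decide
  rw [← hc, ← Set.ncard_coe_finset]
  refine Set.ncard_le_ncard ?_ (h16_S_fin H)
  intro s hs
  simp only [Finset.coe_insert, Finset.coe_singleton, Set.mem_insert_iff,
    Set.mem_singleton_iff] at hs
  rcases hs with rfl | rfl | rfl | rfl | rfl | rfl | rfl | rfl
  · exact h16_mem1 H
  · exact h16_mem2 H (-1) H.bp h31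
  · exact h16_mem2 H 0 H.b h20
  · exact h16_mem2 H 1 H.a h11
  · exact h16_mem2 H 2 H.am h02
  · exact h16_mem3 H 0 1 H.b H.a H.a
  · exact h16_mem3 H 0 0 H.b H.b H.am
  · exact h16_mem3 H (-1) 1 H.bp H.a H.am

/-- the number of partitions of `2β_j + β_{j+1}`. -/
theorem stmt16 (D : ℕ) (hD : 2 ≤ D) (hsq : Squarefree D)
    (β : ℤ → OK) (v : ℤ → ℤ) (hβ : BetaSeq D β v)
    (j : ℤ) (α : OK) (hα : α = (2 : ℤ) • β j + β (j + 1)) :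
    (3 ≤ v j → ¬(v j = 3 ∧ v (j + 1) = 2) → pK D α = 4) ∧
    (v j = 3 → v (j + 1) = 2 → pK D α = 5) ∧
    (v j = 2 → 4 ≤ v (j + 1) → pK D α = 6) ∧
    (v j = 2 → v (j + 1) = 3 → 2 < v (j - 1) → pK D α = 6) ∧
    (v j = 2 → v (j + 1) = 3 → v (j - 1) = 2 → pK D α = 7) ∧
    (v j = 2 → v (j + 1) = 2 → 8 ≤ pK D α) := by
  obtain ⟨T, H, hT⟩ := h16_pK D hD β v hβ j α hα
  rw [hT]
  exact ⟨fun h1 h2 => h16_case1 H h1 (hβ.v_two_le _) h2, fun h1 h2 => h16_case2 H h1 h2,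
    fun h1 h2 => h16_case3 H h1 (Or.inl h2), fun h1 h2 h3 => h16_case3 H h1 (Or.inr ⟨h2, h3⟩),
    fun h1 h2 h3 => h16_case5 H h1 h2 h3, fun h1 h2 => h16_case6 H h1 h2⟩
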